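/- Let Σ = {a,b}, let k ≥ 4 be even, let w = a b² a³ b⁴ ⋯ a^{k-1} b^{k}, and let n = |w| = k(k+1)/2. Then the syntactic complexity of L_w = Σ* w Σ* equals σ(L_w) = (3/2)n² + (5/2)n − kn − 3k + 5. -/

import Mathlib

/-- The two-letter alphabet Σ = {a, b}. -/
inductive Letter : Type
  | a : Letter
  | b : Letter
deriving DecidableEq

/-- The syntactic (Myhill) congruence of a language L, as a setoid on Σ⁺. -/
def synSetoid (L : Set (List Letter)) : Setoid {u : List Letter // u ≠ []} where
  r u v := ∀ x y : List Letter, x ++ u.val ++ y ∈ L ↔ x ++ v.val ++ y ∈ L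
  iseqv := ⟨fun _ _ _ => Iff.rfl, fun h x y => (h x y).symm,
    fun h1 h2 x y => (h1 x y).trans (h2 x y)⟩

/-- The syntactic complexity of L: the cardinality of its syntactic semigroup Σ⁺/≈_L. -/
noncomputable def syntacticComplexity (L : Set (List Letter)) : ℕ :=
  Nat.card (Quotient (synSetoid L))

/-- The language Σ* w Σ* of all words containing w as a factor. -/
def factorLang (w : List Letter) : Set (List Letter) := {u : List Letter | w <:+: u}

/-- The word a b² a³ b⁴ ⋯ : `blockWord k` is the concatenation of blocks of lengths
1, 2, …, k with alternating letters, odd-indexed blocks consisting of a's and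
even-indexed blocks of b's. -/
def blockWord : ℕ → List Letter
  | 0 => []
  | m + 1 => blockWord m ++ List.replicate (m + 1) (if (m + 1) % 2 = 1 then Letter.a else Letter.b)

theorem infix3 {w x u y : List Letter} (h : w <:+: x ++ u ++ y) :
    w <:+: x ∨ w <:+: u ∨ w <:+: y ∨ (∃ l1 l2, w = l1 ++ l2 ∧ l1 <:+ x ∧ l2 <+: u) ∨
    (∃ l1 l2, w = l1 ++ l2 ∧ l1 <:+ u ∧ l2 <+: y) ∨
    (∃ l1 l2, w = l1 ++ u ++ l2 ∧ l1 <:+ x ∧ l2 <+: y) := by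
  rcases List.infix_append_iff.1 h with h | h | ⟨l1, l2, h, h1, h2⟩
  · rcases List.infix_append_iff.1 h with h | h | h
    · exact Or.inl h
    · exact Or.inr (Or.inl h)
    · exact Or.inr (Or.inr (Or.inr (Or.inl h)))
  · exact Or.inr (Or.inr (Or.inl h))
  · obtain ⟨c, hc⟩ := h1
    rcases List.append_eq_append_iff.1 hc with ⟨d, rfl, rfl⟩ | ⟨d, rfl, rfl⟩
    · exact Or.inr (Or.inr (Or.inr (Or.inr (Or.inr ⟨d, l2, by assumption, ⟨c, rfl⟩, h2⟩))))
    · exact Or.inr (Or.inr (Or.inr (Or.inr (Or.inl ⟨_, l2, by assumption, ⟨d, rfl⟩, h2⟩))))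

/-- Longest proper suffix of `w` that is a prefix of `u`. -/
def sufLen (w u : List Letter) : ℕ :=
  Nat.findGreatest (fun t => w.drop (w.length - t) <+: u) (w.length - 1)

/-- Longest proper prefix of `w` that is a suffix of `u`. -/
def preLen (w u : List Letter) : ℕ :=
  Nat.findGreatest (fun t => w.take t <:+ u) (w.length - 1)

/-- `u` has an occurrence strictly inside `w`. -/
def InnerIn (w u : List Letter) : Prop := ∃ p q, p ≠ [] ∧ q ≠ [] ∧ w = p ++ u ++ q

theorem sufLen_spec (w u : List Letter) : w.drop (w.length - sufLen w u) <+: u := by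
  unfold sufLen
  exact Nat.findGreatest_spec (P := fun t => w.drop (w.length - t) <+: u)
    (Nat.zero_le _) (by simp)

theorem preLen_spec (w u : List Letter) : w.take (preLen w u) <:+ u := by
  unfold preLen
  exact Nat.findGreatest_spec (P := fun t => w.take t <:+ u) (Nat.zero_le _) (by simp)

theorem sufLen_le (w u : List Letter) : sufLen w u ≤ w.length - 1 := Nat.findGreatest_le _

theorem preLen_le (w u : List Letter) : preLen w u ≤ w.length - 1 := Nat.findGreatest_le _

theorem sufLen_le_length (w u : List Letter) : sufLen w u ≤ u.length := by
  have h1 := (sufLen_spec w u).length_le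
  have h2 := sufLen_le w u
  simp at h1; omega

theorem preLen_le_length (w u : List Letter) : preLen w u ≤ u.length := by
  have h1 := (preLen_spec w u).length_le
  have h2 := preLen_le w u
  simp at h1; omega

theorem le_sufLen {w u l1 l2 : List Letter} (h : w = l1 ++ l2) (h1 : l1 ≠ []) (h2 : l2 <+: u) :
    l2.length ≤ sufLen w u := by
  have := List.length_pos_iff.2 h1
  apply Nat.le_findGreatest
  · simp [h]; omega
  · simpa [h] using h2

theorem le_preLen {w u l1 l2 : List Letter} (h : w = l1 ++ l2) (h2 : l2 ≠ []) (h1 : l1 <:+ u) :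
    l1.length ≤ preLen w u := by
  have := List.length_pos_iff.2 h2
  apply Nat.le_findGreatest
  · simp [h]; omega
  · simpa [h] using h1

theorem not_inner_mem {w u : List Letter} (h : InnerIn w u) : ¬ w <:+: u := by
  obtain ⟨p, q, hp, hq, rfl⟩ := h
  intro h
  have := h.length_le
  have := List.length_pos_iff.2 hp
  simp at *; omega

theorem eqv_of_data {w u v : List Letter} (hu : ¬ w <:+: u) (hi : ¬ InnerIn w u)
    (hS : sufLen w u = sufLen w v) (hP : preLen w u = preLen w v)
    {x y : List Letter} (h : w <:+: x ++ u ++ y) : w <:+: x ++ v ++ y := by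
  rcases infix3 h with h | h | h | ⟨l1, l2, h, h1, h2⟩ | ⟨l1, l2, h, h1, h2⟩ | ⟨l1, l2, h, h1, h2⟩
  · rw [List.append_assoc]; exact List.infix_append_of_infix_left h
  · exact absurd h hu
  · exact List.infix_append_of_infix_right h
  · have hl1 : l1 ≠ [] := by
      rintro rfl
      exact hu (by rw [h]; exact h2.isInfix)
    have hle := le_sufLen h hl1 h2
    have hsp := sufLen_spec w u
    have hsv := sufLen_spec w v
    rw [← hS] at hsv
    have := List.prefix_of_prefix_length_le h2 hsp (by
      have := sufLen_le w u
      simp; omega)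
    have h3 := this.trans hsv
    rw [h]
    obtain ⟨c, rfl⟩ := h1
    obtain ⟨d, rfl⟩ := h3
    exact ⟨c, d ++ y, by simp⟩
  · have hl1 : l2 ≠ [] := by
      rintro rfl
      exact hu (by rw [h]; simpa using h1.isInfix)
    have hle := le_preLen h hl1 h1
    have hsp := preLen_spec w u
    have hsv := preLen_spec w v
    rw [← hP] at hsv
    have := List.suffix_of_suffix_length_le h1 hsp (by
      have := preLen_le w u
      simp; omega)
    have h3 := this.trans hsv
    rw [h]
    obtain ⟨c, rfl⟩ := h2
    obtain ⟨d, rfl⟩ := h3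
    exact ⟨x ++ d, c, by simp⟩
  · by_cases e1 : l1 = []
    · subst e1
      by_cases e2 : l2 = []
      · subst e2; exact absurd (by rw [h]; simp) hu
      simp only [List.nil_append] at h
      have hle := le_preLen h e2 (List.suffix_refl u)
      have hsp := preLen_spec w u
      have hsv := preLen_spec w v
      rw [← hP] at hsv
      have := List.suffix_of_suffix_length_le (List.suffix_refl u) hsp (by
        have := preLen_le w u
        simp; omega)
      have h3 := this.trans hsv
      rw [h]
      obtain ⟨c, rfl⟩ := h2
      obtain ⟨d, rfl⟩ := h3
      exact ⟨x ++ d, c, by simp⟩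
    · by_cases e2 : l2 = []
      · subst e2
        simp only [List.append_nil] at h
        have hle := le_sufLen h e1 (List.prefix_refl u)
        have hsp := sufLen_spec w u
        have hsv := sufLen_spec w v
        rw [← hS] at hsv
        have := List.prefix_of_prefix_length_le (List.prefix_refl u) hsp (by
          have := sufLen_le w u
          simp; omega)
        have h3 := this.trans hsv
        rw [h]
        obtain ⟨c, rfl⟩ := h1
        obtain ⟨d, rfl⟩ := h3
        exact ⟨c, d ++ y, by simp⟩
      · exact absurd ⟨l1, l2, e1, e2, h⟩ hi

theorem sufLen_mono_of {w u v : List Letter} (hv : ¬ w <:+: v)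
    (H : ∀ x y, w <:+: x ++ u ++ y → w <:+: x ++ v ++ y) : sufLen w u ≤ sufLen w v := by
  have hs := sufLen_spec w u
  have hle := sufLen_le w u
  by_cases h0 : sufLen w u = 0
  · omega
  have h1 := H (w.take (w.length - sufLen w u)) [] (by
    obtain ⟨d, hd⟩ := hs
    refine ⟨[], d, ?_⟩
    generalize sufLen w u = t at hd
    rw [← hd]
    simp [← List.append_assoc])
  rw [List.append_nil] at h1
  rcases List.infix_append_iff.1 h1 with h | h | ⟨l1, l2, h, h1, h2⟩
  · have := h.length_le
    simp at this; omega
  · exact absurd h hv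
  · have hl1 : l1 ≠ [] := by
      rintro rfl
      exact hv (by rw [h]; exact h2.isInfix)
    have h3 := le_sufLen h hl1 h2
    have h4 := h1.length_le
    have h5 := congrArg List.length h
    simp at h4 h5; omega

theorem preLen_mono_of {w u v : List Letter} (hv : ¬ w <:+: v)
    (H : ∀ x y, w <:+: x ++ u ++ y → w <:+: x ++ v ++ y) : preLen w u ≤ preLen w v := by
  have hs := preLen_spec w u
  have hle := preLen_le w u
  by_cases h0 : preLen w u = 0
  · omega
  have h1 := H [] (w.drop (preLen w u)) (by
    obtain ⟨d, hd⟩ := hs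
    refine ⟨d, [], ?_⟩
    generalize preLen w u = t at hd
    rw [← hd]
    simp)
  rw [List.nil_append] at h1
  rcases List.infix_append_iff.1 h1 with h | h | ⟨l1, l2, h, h1, h2⟩
  · exact absurd h hv
  · have := h.length_le
    simp at this; omega
  · have hl1 : l2 ≠ [] := by
      rintro rfl
      exact hv (by rw [h]; simpa using h1.isInfix)
    have h3 := le_preLen h hl1 h1
    have h4 := h2.length_le
    have h5 := congrArg List.length h
    simp at h4 h5; omega

theorem inner_of_eqv {w u v : List Letter} (hv : ¬ w <:+: v) (hi : InnerIn w u)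
    (hS : sufLen w u = sufLen w v) (hP : preLen w u = preLen w v)
    (H : ∀ x y, w <:+: x ++ u ++ y → w <:+: x ++ v ++ y) :
    InnerIn w v ∧ u.length ≤ v.length ∧ (u.length = v.length → u = v) := by
  obtain ⟨p, q, hp, hq, hw⟩ := hi
  have h1 := H p q (by rw [← hw])
  have hlen := congrArg List.length hw
  have hp' := List.length_pos_iff.2 hp
  have hq' := List.length_pos_iff.2 hq
  have s1 := sufLen_le_length w u
  have s2 := preLen_le_length w u
  simp only [List.length_append] at hlen
  rcases infix3 h1 with h | h | h | ⟨l1, l2, h, h1, h2⟩ | ⟨l1, l2, h, h1, h2⟩ | ⟨l1, l2, h, h1, h2⟩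
  · have := h.length_le; omega
  · exact absurd h hv
  · have := h.length_le; omega
  · have hl1 : l1 ≠ [] := by
      rintro rfl
      exact hv (by rw [h]; exact h2.isInfix)
    have h3 := le_sufLen h hl1 h2
    have h4 := h1.length_le
    have h5 := congrArg List.length h
    simp at h5; omega
  · have hl1 : l2 ≠ [] := by
      rintro rfl
      exact hv (by rw [h]; simpa using h1.isInfix)
    have h3 := le_preLen h hl1 h1
    have h4 := h2.length_le
    have h5 := congrArg List.length h
    simp at h5; omega
  · have h4 := h1.length_le
    have h4' := h2.length_le
    have h5 := congrArg List.length h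
    simp only [List.length_append] at h5
    have e1 : l1 ≠ [] := by
      rintro rfl
      have e2 : l2 ≠ [] := by
        rintro rfl
        exact hv (by rw [h]; simp)
      simp only [List.nil_append] at h
      have h3 := le_preLen h e2 (List.suffix_refl v)
      simp at h5; omega
    have e2 : l2 ≠ [] := by
      rintro rfl
      simp only [List.append_nil] at h
      have h3 := le_sufLen h e1 (List.prefix_refl v)
      simp at h5; omega
    refine ⟨⟨l1, l2, e1, e2, h⟩, by omega, fun huv => ?_⟩
    rw [hw] at h
    have h6 := List.append_inj_left h (by simp; omega)
    exact List.append_inj_right h6 (by omega)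

open Classical in
/-- Complete invariant of the syntactic congruence. -/
noncomputable def synInv (w : List Letter) (u : {u : List Letter // u ≠ []}) :
    Option (List Letter ⊕ (ℕ × ℕ)) :=
  if w <:+: u.val then none else
  if InnerIn w u.val then some (Sum.inl u.val) else
  some (Sum.inr (sufLen w u.val, preLen w u.val))

theorem synInv_iff (w : List Letter) (u v : {u : List Letter // u ≠ []}) :
    (synSetoid (factorLang w)) u v ↔ synInv w u = synInv w v := by
  change (∀ x y, w <:+: x ++ u.val ++ y ↔ w <:+: x ++ v.val ++ y) ↔ _
  constructor
  · intro H
    have h0 := H [] []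
    simp only [List.nil_append, List.append_nil] at h0
    unfold synInv
    by_cases hu : w <:+: u.val
    · rw [if_pos hu, if_pos (h0.1 hu)]
    have hv : ¬ w <:+: v.val := fun h => hu (h0.2 h)
    rw [if_neg hu, if_neg hv]
    have hS := le_antisymm (sufLen_mono_of hv fun x y => (H x y).1)
      (sufLen_mono_of hu fun x y => (H x y).2)
    have hP := le_antisymm (preLen_mono_of hv fun x y => (H x y).1)
      (preLen_mono_of hu fun x y => (H x y).2)
    by_cases hi : InnerIn w u.val
    · obtain ⟨hi', hl, he⟩ := inner_of_eqv hv hi hS hP fun x y => (H x y).1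
      obtain ⟨-, hl', -⟩ := inner_of_eqv hu hi' hS.symm hP.symm fun x y => (H x y).2
      rw [if_pos hi, if_pos hi', he (le_antisymm hl hl')]
    · have hi' : ¬ InnerIn w v.val := fun h =>
        hi (inner_of_eqv hu h hS.symm hP.symm fun x y => (H x y).2).1
      rw [if_neg hi, if_neg hi', hS, hP]
  · intro h
    unfold synInv at h
    intro x y
    by_cases hu : w <:+: u.val <;> by_cases hv : w <:+: v.val
    · exact ⟨fun _ => (hv.trans (List.infix_append x v.val y)),
        fun _ => (hu.trans (List.infix_append x u.val y))⟩
    · rw [if_pos hu, if_neg hv] at h; split_ifs at h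
    · rw [if_neg hu, if_pos hv] at h; split_ifs at h
    · rw [if_neg hu, if_neg hv] at h
      split_ifs at h with h1 h2 h2
      · simp at h; rw [h]
      · simp at h
      · simp at h
      · simp at h
        exact ⟨eqv_of_data hu h1 h.1 h.2, eqv_of_data hv h2 h.1.symm h.2.symm⟩

theorem real_word {w : List Letter} {w1 w2 : List Letter} (ha : w = Letter.a :: w1)
    (hb : w = w2 ++ [Letter.b]) (hab : ∀ i j, w ≠ List.replicate i Letter.a ++ List.replicate j Letter.b)
    {s p : ℕ} (hs : s < w.length) (hp : p < w.length) :
    ∃ u : {u : List Letter // u ≠ []}, synInv w u = some (Sum.inr (s, p)) := by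
  set n := w.length with hn
  have hnpos : 0 < n := by omega
  let X := w.drop (n - s)
  let Y := w.take p
  have hX : X.length = s := by simp [X]; omega
  have hY : Y.length = p := by simp [Y]; omega
  let A := List.replicate n Letter.a
  let B := List.replicate n Letter.b
  let u := X ++ A ++ (B ++ Y)
  have hnotA : ∀ Z : List Letter, ∀ j, 0 < j → ∀ c, w ≠ c ++ (Z ++ List.replicate j Letter.a) := by
    intro Z j hj c h
    rw [hb] at h
    have := congrArg List.getLast? h
    obtain ⟨j, rfl⟩ : ∃ i, j = i + 1 := ⟨j - 1, by omega⟩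
    rw [List.replicate_succ', ← List.append_assoc, ← List.append_assoc] at this
    simp at this
  have hnotB : ∀ Z : List Letter, ∀ j, 0 < j → w ≠ List.replicate j Letter.b ++ Z := by
    intro Z j hj h
    rw [ha] at h
    obtain ⟨j, rfl⟩ : ∃ i, j = i + 1 := ⟨j - 1, by omega⟩
    simp [List.replicate_succ] at h
  -- no short prefix of u beyond X is a suffix of w
  have key1 : ∀ l1 l2, w = l1 ++ l2 → l2 <+: X ++ A → l2.length ≤ s := by
    intro l1 l2 h h2
    by_contra hc
    obtain ⟨d, hd⟩ := h2
    rcases List.append_eq_append_iff.1 hd with ⟨e, he, -⟩ | ⟨e, he, he'⟩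
    · have := congrArg List.length he
      simp at this; omega
    · obtain ⟨-, he2, -⟩ := List.append_eq_replicate_iff.1 he'.symm
      have hl := congrArg List.length he
      simp only [List.length_append] at hl
      exact hnotA X e.length (by omega) l1 (by rw [h, he]; congr 2)
  have key2 : ∀ l1 l2, w = l1 ++ l2 → l1 <:+ B ++ Y → l1.length ≤ p := by
    intro l1 l2 h h2
    by_contra hc
    obtain ⟨d, hd⟩ := h2
    rcases List.append_eq_append_iff.1 hd with ⟨e, he, he'⟩ | ⟨e, he, he'⟩
    · obtain ⟨-, -, he2⟩ := List.append_eq_replicate_iff.1 he.symm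
      have hl := congrArg List.length he'
      simp only [List.length_append] at hl
      exact hnotB (Y ++ l2) e.length (by omega) (by rw [h, he', ← he2]; simp)
    · have := congrArg List.length he'
      simp at this; omega
  have hlen : u.length = s + n + (n + p) := by simp [u, A, B, hX, hY]; omega
  have hune : u ≠ [] := by
    intro h; rw [h] at hlen; simp at hlen; omega
  have hXw : w = w.take (n - s) ++ X := by simp [X]
  have hYw : w = Y ++ w.drop p := by simp [Y]
  have hS : sufLen w u = s := by
    apply le_antisymm
    · have h1 := sufLen_spec w u
      have h3 := sufLen_le w u
      have h4 : w.drop (w.length - sufLen w u) <+: X ++ A := by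
        refine List.prefix_of_prefix_length_le h1 (List.prefix_append _ _) ?_
        simp [A, hX]; omega
      have h2 := key1 _ _ (List.take_append_drop _ _).symm h4
      simp at h2; omega
    · have := le_sufLen (u := u) hXw (by
        intro h
        have := congrArg List.length h
        simp only [List.length_take, List.length_nil] at this; omega) (by simp [u])
      omega
  have hP : preLen w u = p := by
    apply le_antisymm
    · have h1 := preLen_spec w u
      have h3 := preLen_le w u
      have h4 : w.take (preLen w u) <:+ B ++ Y := by
        refine List.suffix_of_suffix_length_le h1 (List.suffix_append _ _) ?_
        simp [B, hY]; omega
      have h2 := key2 _ _ (List.take_append_drop _ _).symm h4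
      simp at h2; omega
    · have := le_preLen (u := u) hYw (by
        intro h
        have := congrArg List.length h
        simp at this; omega) (by
        simp only [u, ← List.append_assoc]; exact List.suffix_append _ _)
      omega
  have hL : ¬ w <:+: u := by
    intro h
    have hXA : ¬ w <:+: X ++ A := by
      rintro ⟨c, d, h⟩
      rcases List.append_eq_append_iff.1 h with ⟨e, he, he'⟩ | ⟨e, he, he'⟩
      · have := congrArg List.length he
        simp at this; omega
      · obtain ⟨-, he2, -⟩ := List.append_eq_replicate_iff.1 he'.symm
        rcases Nat.eq_zero_or_pos e.length with h0 | h0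
        · have := congrArg List.length he
          simp at this; omega
        · rw [he2] at he
          rcases List.append_eq_append_iff.1 he with ⟨f, hf, hf'⟩ | ⟨f, hf, hf'⟩
          · exact hnotA f e.length h0 [] (by simpa using hf')
          · have h7 := congrArg List.length hf'
            simp only [List.length_append, List.length_replicate] at h7
            obtain ⟨-, -, h8⟩ := List.append_eq_replicate_iff.1 hf'.symm
            rw [List.eq_replicate_iff] at h8
            have : w = List.replicate n Letter.a := List.eq_replicate_iff.2 ⟨rfl, h8.2⟩
            exact hab n 0 (by simpa using this)
    have hBY : ¬ w <:+: B ++ Y := by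
      intro h
      rcases List.infix_append_iff.1 h with h | h | ⟨l1, l2, h, h1, h2⟩
      · have : Letter.a ∈ B := h.subset (by rw [ha]; simp)
        simp [B] at this
      · have := h.length_le; omega
      · obtain ⟨d, hd⟩ := h1
        obtain ⟨-, -, h8⟩ := List.append_eq_replicate_iff.1 hd
        rcases Nat.eq_zero_or_pos l1.length with h0 | h0
        · have h9 := h2.length_le
          have := congrArg List.length h
          simp at this; omega
        · exact hnotB l2 l1.length h0 (by rw [h8] at h; simpa using h)
    rcases List.infix_append_iff.1 h with h | h | ⟨l1, l2, h, h1, h2⟩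
    · exact hXA h
    · exact hBY h
    · have hl := congrArg List.length h
      simp only [List.length_append] at hl
      have e1 : l1 <:+ A := List.suffix_of_suffix_length_le h1 (List.suffix_append _ _)
        (by simp [A]; omega)
      have e2 : l2 <+: B := List.prefix_of_prefix_length_le h2 (List.prefix_append _ _)
        (by simp [B]; omega)
      obtain ⟨d, hd⟩ := e1
      obtain ⟨-, -, h8⟩ := List.append_eq_replicate_iff.1 hd
      obtain ⟨d', hd'⟩ := e2
      obtain ⟨-, h9, -⟩ := List.append_eq_replicate_iff.1 hd'
      rw [h8, h9] at h
      exact hab _ _ h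
  have hI : ¬ InnerIn w u := by
    rintro ⟨c, d, hc, hd, h⟩
    have := congrArg List.length h
    have := List.length_pos_iff.2 hc
    simp only [List.length_append] at *; omega
  exact ⟨⟨u, hune⟩, by simp [synInv, hL, hI, hS, hP]⟩

theorem syntacticComplexity_eq {w : List Letter} {w1 w2 : List Letter} (ha : w = Letter.a :: w1)
    (hb : w = w2 ++ [Letter.b])
    (hab : ∀ i j, w ≠ List.replicate i Letter.a ++ List.replicate j Letter.b)
    (I : Finset (List Letter)) (hI : ∀ u, u ∈ I ↔ u ≠ [] ∧ InnerIn w u) :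
    syntacticComplexity (factorLang w) = 1 + I.card + w.length ^ 2 := by
  have hset : synSetoid (factorLang w) = Setoid.ker (synInv w) := by
    ext u v
    exact synInv_iff w u v
  have hrange : Set.range (synInv w) = ((Finset.insertNone
      (I.disjSum (Finset.range w.length ×ˢ Finset.range w.length))) :
      Set (Option (List Letter ⊕ (ℕ × ℕ)))) := by
    have hpos : 0 < w.length := by rw [ha]; simp
    ext z
    constructor
    · rintro ⟨u, rfl⟩
      have := sufLen_le w u.val
      have := preLen_le w u.val
      unfold synInv
      split_ifs with h1 h2
      · simp
      · simp [hI, h2, u.2]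
      · simp; omega
    · intro hz
      rcases z with _ | z | ⟨s, p⟩
      · exact ⟨⟨w, by rw [ha]; simp⟩, by simp [synInv]⟩
      · have hz : z ∈ I := by simpa using hz
        obtain ⟨h1, h2⟩ := (hI z).1 hz
        exact ⟨⟨z, h1⟩, by simp [synInv, not_inner_mem h2, h2]⟩
      · have hz : s < w.length ∧ p < w.length := by simpa using hz
        exact real_word ha hb hab hz.1 hz.2
  unfold syntacticComplexity
  rw [hset, Nat.card_congr (Setoid.quotientKerEquivRange _), hrange]
  rw [Nat.card_coe_set_eq, Set.ncard_coe_finset, Finset.card_insertNone, Finset.card_disjSum,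
    Finset.card_product, Finset.card_range]
  ring

/-- Triangular numbers. -/
def triN : ℕ → ℕ
  | 0 => 0
  | m + 1 => triN m + (m + 1)

theorem triN_succ (m : ℕ) : triN (m + 1) = triN m + (m + 1) := rfl

theorem triN_mono : Monotone triN := monotone_nat_of_le_succ fun m => by rw [triN_succ]; omega

theorem triN_strictMono : StrictMono triN :=
  strictMono_nat_of_lt_succ fun m => by rw [triN_succ]; omega

theorem triN_two (m : ℕ) : 2 * triN m = m * (m + 1) := by
  induction m with
  | zero => rfl
  | succ m ih => rw [triN_succ]; linarith

theorem le_triN (m : ℕ) : m ≤ triN m := triN_strictMono.le_apply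

/-- Block index of position `p`. -/
def blkN (p : ℕ) : ℕ := Nat.findGreatest (fun m => triN m ≤ p) p

theorem blkN_le (p : ℕ) : triN (blkN p) ≤ p :=
  Nat.findGreatest_spec (P := fun m => triN m ≤ p) (Nat.zero_le p) (Nat.zero_le p)

theorem blkN_lt (p : ℕ) : p < triN (blkN p + 1) := by
  by_contra h
  have h1 : triN (blkN p + 1) ≤ p := by omega
  have h2 : blkN p + 1 ≤ blkN p :=
    Nat.le_findGreatest (P := fun m => triN m ≤ p) ((le_triN _).trans h1) h1
  omega

theorem blkN_eq {p m : ℕ} (h1 : triN m ≤ p) (h2 : p < triN (m + 1)) : blkN p = m := by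
  have h3 := blkN_le p
  have h4 := blkN_lt p
  have h5 : m < blkN p + 1 := triN_strictMono.lt_iff_lt.1 (h1.trans_lt h4)
  have h6 : blkN p < m + 1 := triN_strictMono.lt_iff_lt.1 (h3.trans_lt h2)
  omega

/-- The infinite word a b b a a a .... -/
def letN (p : ℕ) : Letter := if blkN p % 2 = 0 then Letter.a else Letter.b

theorem letN_eq {p m : ℕ} (h1 : triN m ≤ p) (h2 : p < triN (m + 1)) :
    letN p = if m % 2 = 0 then Letter.a else Letter.b := by
  rw [letN, blkN_eq h1 h2]

/-- The factor of the infinite word on positions `[s, e)`. -/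
def facN (s e : ℕ) : List Letter := (List.range' s (e - s)).map letN

theorem facN_length (s e : ℕ) : (facN s e).length = e - s := by simp [facN]

theorem facN_append {s m e : ℕ} (h1 : s ≤ m) (h2 : m ≤ e) : facN s m ++ facN m e = facN s e := by
  unfold facN
  rw [← List.map_append]
  congr 1
  have := List.range'_append_1 (s := s) (m := m - s) (n := e - m)
  rw [show s + (m - s) = m by omega] at this
  rw [this]
  congr 1
  omega

theorem facN_eq_iff {s e s' e' : ℕ} : facN s e = facN s' e' ↔
    e - s = e' - s' ∧ ∀ t < e - s, letN (s + t) = letN (s' + t) := by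
  constructor
  · intro h
    have hl := congrArg List.length h
    simp only [facN_length] at hl
    refine ⟨hl, fun t ht => ?_⟩
    have h1 : (facN s e)[t]? = (facN s' e')[t]? := by rw [h]
    simp only [facN, List.getElem?_map, List.getElem?_range' ht,
      List.getElem?_range' (hl ▸ ht)] at h1
    simpa using h1
  · rintro ⟨hl, h⟩
    apply List.ext_getElem
    · simp [facN_length, hl]
    · intro t h1 h2
      simp only [facN_length] at h1
      simpa [facN] using h t h1

theorem blockWord_eq (k : ℕ) : blockWord k = facN 0 (triN k) := by
  induction k with
  | zero => rfl
  | succ m ih =>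
    rw [blockWord, ih, ← facN_append (Nat.zero_le (triN m)) (triN_mono (Nat.le_succ m))]
    congr 1
    symm
    rw [List.eq_replicate_iff]
    refine ⟨by rw [facN_length, triN_succ]; omega, ?_⟩
    intro c hc
    simp only [facN, List.mem_map, List.mem_range'_1] at hc
    obtain ⟨p, ⟨h1, h2⟩, rfl⟩ := hc
    have := triN_succ m
    rw [Nat.succ_eq_add_one] at h2
    rw [letN_eq h1 (by omega)]
    rcases Nat.mod_two_eq_zero_or_one m with h | h
    · rw [if_pos h, if_pos (by omega)]
    · rw [if_neg (by omega), if_neg (by omega)]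

theorem innerIn_iff (k : ℕ) (u : List Letter) : InnerIn (blockWord k) u ↔
    ∃ s e, 1 ≤ s ∧ s ≤ e ∧ e < triN k ∧ u = facN s e := by
  rw [blockWord_eq]
  constructor
  · rintro ⟨p, q, hp, hq, h⟩
    have hl := congrArg List.length h
    simp only [facN_length, List.length_append] at hl
    have := List.length_pos_iff.2 hp
    have := List.length_pos_iff.2 hq
    refine ⟨p.length, p.length + u.length, by omega, by omega, by omega, ?_⟩
    rw [← facN_append (m := p.length + u.length) (by omega) (by omega),
      ← facN_append (m := p.length) (by omega) (by omega)] at h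
    have h1 := List.append_inj_left h (by simp [facN_length])
    exact (List.append_inj_right h1 (by simp [facN_length])).symm
  · rintro ⟨s, e, h1, h2, h3, rfl⟩
    refine ⟨facN 0 s, facN e (triN k), ?_, ?_, ?_⟩
    · rw [← List.length_pos_iff, facN_length]; omega
    · rw [← List.length_pos_iff, facN_length]; omega
    · rw [facN_append (by omega) h2, facN_append (by omega) (by omega)]

/-- A factor with two letter changes has a unique position. -/
theorem unique_pos {m d : ℕ} (hd : 0 < d) (hm : 1 ≤ triN m)
    (h : ∀ p, triN m ≤ p + 1 → p ≤ triN (m + 1) → letN p = letN (p + d)) : False := by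
  have hs := triN_succ m
  have hs2 := triN_succ (m + 1)
  have hmpos : 1 ≤ m := by
    rcases Nat.eq_zero_or_pos m with rfl | h
    · simp [triN] at hm
    · exact h
  obtain ⟨l, rfl⟩ : ∃ l, m = l + 1 := ⟨m - 1, by omega⟩
  have hs3 := triN_succ l
  have a1 := h (triN (l + 1) - 1) (by omega) (by omega)
  have a2 := h (triN (l + 1)) (by omega) (by omega)
  have a3 := h (triN (l + 1 + 1)) (by omega) (by omega)
  have b1 := letN_eq (p := triN (l + 1) - 1) (m := l) (by omega) (by omega)
  have b2 := letN_eq (p := triN (l + 1)) (m := l + 1) (by omega) (by omega)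
  have b3 := letN_eq (p := triN (l + 1 + 1)) (m := l + 1 + 1) (by omega) (by omega)
  have c1 := blkN_le (triN (l + 1) + d)
  have c2 := blkN_lt (triN (l + 1) + d)
  set q := blkN (triN (l + 1) + d) with hq
  have hqs := triN_succ q
  have d2 := letN_eq c1 c2
  have hlq : l + 1 < q + 1 := triN_strictMono.lt_iff_lt.1 (show triN (l+1) < triN (q+1) by omega)
  rcases Nat.lt_or_ge (triN q) (triN (l + 1) + d) with hlt | hge
  · have d1 := letN_eq (p := triN (l + 1) - 1 + d) (m := q) (by omega) (by omega)
    rw [d1, b1] at a1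
    rw [d2, b2] at a2
    rw [← a2] at a1
    rcases Nat.mod_two_eq_zero_or_one l with h | h
    · rw [if_pos h, if_neg (by omega)] at a1; cases a1
    · rw [if_neg (by omega), if_pos (by omega)] at a1; cases a1
  · have hne : q ≠ l + 1 := by
      intro h; rw [h] at c1 hge; omega
    have d1 := letN_eq (p := triN (l + 1 + 1) + d) (m := q) (by omega) (by omega)
    rw [d1, b3] at a3
    rw [d2, b2] at a2
    rw [← a2] at a3
    rcases Nat.mod_two_eq_zero_or_one l with h | h
    · rw [if_pos (by omega), if_neg (by omega)] at a3; cases a3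
    · rw [if_neg (by omega), if_pos (by omega)] at a3; cases a3

/-- Lower bound of the end positions of canonical factors starting at `s`, for `k = K + 4`. -/
def loN (K s : ℕ) : ℕ :=
  if s < triN (K + 1) then triN (blkN s + 2) + 1
  else if s < triN (K + 2) then triN (K + 2) + 1
  else if s < triN (K + 3) then triN (K + 3) else triN (K + 3) + 1

/-- Canonical positions of inner factors. -/
def canN (K : ℕ) : Finset (Σ _ : ℕ, ℕ) :=
  (Finset.Ico 1 (triN (K + 3) + 1)).sigma fun s => Finset.Ico (loN K s) (triN (K + 4))

theorem mem_canN {K s e : ℕ} : (⟨s, e⟩ : Σ _ : ℕ, ℕ) ∈ canN K ↔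
    (1 ≤ s ∧ s ≤ triN (K + 3)) ∧ loN K s ≤ e ∧ e < triN (K + 4) := by
  simp [canN]

theorem lt_of_loN {K s e : ℕ} (hs : s ≤ triN (K + 3)) (h : loN K s ≤ e) : s < e := by
  unfold loN at h
  have := blkN_lt s
  have := triN_succ (blkN s + 1)
  simp only [Nat.add_assoc, Nat.reduceAdd] at this
  split_ifs at h <;> omega

theorem canN_inj_aux {K s e s' e' : ℕ} (hK : K % 2 = 0)
    (h : (⟨s, e⟩ : Σ _ : ℕ, ℕ) ∈ canN K) (h' : (⟨s', e'⟩ : Σ _ : ℕ, ℕ) ∈ canN K)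
    (heq : facN s e = facN s' e') (hlt : s < s') : False := by
  rw [mem_canN] at h h'
  obtain ⟨⟨h1, h2⟩, h3, h4⟩ := h
  obtain ⟨⟨h1', h2'⟩, h3', h4'⟩ := h'
  have l1 := lt_of_loN h2 h3
  have l2 := lt_of_loN h2' h3'
  obtain ⟨hl, ht⟩ := facN_eq_iff.1 heq
  have hsh : ∀ p, s ≤ p → p < e → letN p = letN (p + (s' - s)) := by
    intro p hp1 hp2
    have := ht (p - s) (by omega)
    rw [show s + (p - s) = p by omega, show s' + (p - s) = p + (s' - s) by omega] at this
    exact this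
  have t2 := triN_succ (K + 1)
  have t3 := triN_succ (K + 2)
  have t4 := triN_succ (K + 3)
  simp only [Nat.add_assoc, Nat.reduceAdd] at t2 t3 t4
  unfold loN at h3
  split_ifs at h3 with c1 c2 c3
  · have b1 := blkN_lt s
    exact unique_pos (m := blkN s + 1) (d := s' - s) (by omega) (by omega)
      (fun p hp1 hp2 => hsh p (by omega)
        (by simp only [Nat.add_assoc, Nat.reduceAdd] at hp2; omega))
  · by_cases he : triN (K + 3) < e
    · exact unique_pos (m := K + 2) (d := s' - s) (by omega) (by omega)
        (fun p hp1 hp2 => hsh p (by omega)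
          (by simp only [Nat.add_assoc, Nat.reduceAdd] at hp2; omega))
    · have a1 := hsh (triN (K + 2) - 1) (by omega) (by omega)
      have a2 := hsh (triN (K + 2)) (by omega) (by omega)
      rw [letN_eq (m := K + 1) (by omega) (by simp only [Nat.add_assoc, Nat.reduceAdd]; omega),
        if_neg (by omega)] at a1
      rw [letN_eq (m := K + 2) (by omega) (by simp only [Nat.add_assoc, Nat.reduceAdd]; omega),
        if_pos (by omega)] at a2
      rcases Nat.lt_or_ge (triN (K + 2) + (s' - s)) (triN (K + 3)) with hq | hq
      · rw [letN_eq (m := K + 2) (by omega) (by simp only [Nat.add_assoc, Nat.reduceAdd]; omega),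
          if_pos (by omega)] at a1
        cases a1
      · rw [letN_eq (m := K + 3) (by omega) (by simp only [Nat.add_assoc, Nat.reduceAdd]; omega),
          if_neg (by omega)] at a2
        cases a2
  · have a1 := hsh (triN (K + 3) - 1) (by omega) (by omega)
    rw [letN_eq (m := K + 2) (by omega) (by simp only [Nat.add_assoc, Nat.reduceAdd]; omega),
      if_pos (by omega), letN_eq (m := K + 3) (by omega)
        (by simp only [Nat.add_assoc, Nat.reduceAdd]; omega), if_neg (by omega)] at a1
    cases a1
  · omega

theorem canN_inj {K : ℕ} (hK : K % 2 = 0) :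
    Set.InjOn (fun z : Σ _ : ℕ, ℕ => facN z.1 z.2) (canN K) := by
  rintro ⟨s, e⟩ h ⟨s', e'⟩ h' heq
  simp only at heq
  have h : (⟨s, e⟩ : Σ _ : ℕ, ℕ) ∈ canN K := h
  have h' : (⟨s', e'⟩ : Σ _ : ℕ, ℕ) ∈ canN K := h'
  have hs : s = s' := by
    rcases lt_trichotomy s s' with hc | hc | hc
    · exact (canN_inj_aux hK h h' heq hc).elim
    · exact hc
    · exact (canN_inj_aux hK h' h heq.symm hc).elim
  subst hs
  rw [mem_canN] at h h'
  have l1 := lt_of_loN h.1.2 h.2.1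
  have l2 := lt_of_loN h'.1.2 h'.2.1
  have := (facN_eq_iff.1 heq).1
  have : e = e' := by omega
  subst this
  rfl

theorem canN_surj {K : ℕ} (hK : K % 2 = 0) {s e : ℕ} (h1 : 1 ≤ s) (h2 : s < e)
    (h3 : e < triN (K + 4)) : ∃ z ∈ canN K, facN z.1 z.2 = facN s e := by
  have t1 := triN_succ K
  have t2 := triN_succ (K + 1)
  have t3 := triN_succ (K + 2)
  have t4 := triN_succ (K + 3)
  simp only [Nat.add_assoc, Nat.reduceAdd] at t2 t3 t4
  have b1 := blkN_le s
  have b2 := blkN_lt s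
  set m := blkN s with hm
  have m1 := triN_succ m
  have m2 := triN_succ (m + 1)
  simp only [Nat.add_assoc, Nat.reduceAdd] at m2
  have q0 : 1 ≤ triN (K + 1) := le_trans (by omega) (le_triN (K + 1))
  have hlo1 : ∀ x, triN (K + 1) ≤ x → x < triN (K + 2) → loN K x = triN (K + 2) + 1 := by
    intro x hx1 hx2
    rw [loN, if_neg (by omega), if_pos hx2]
  have hlo2 : ∀ x, triN (K + 2) ≤ x → x < triN (K + 3) → loN K x = triN (K + 3) := by
    intro x hx1 hx2
    rw [loN, if_neg (by omega), if_neg (by omega), if_pos hx2]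
  have hlo3 : loN K (triN (K + 3)) = triN (K + 3) + 1 := by
    rw [loN, if_neg (by omega), if_neg (by omega), if_neg (by omega)]
  have hmk : m < K + 4 := triN_strictMono.lt_iff_lt.1 (show triN m < triN (K + 4) by omega)
  by_cases e1 : triN (m + 2) < e
  · have : m + 2 < K + 4 :=
      triN_strictMono.lt_iff_lt.1 (show triN (m + 2) < triN (K + 4) by omega)
    refine ⟨⟨s, e⟩, ?_, rfl⟩
    rw [mem_canN]
    by_cases e2 : m ≤ K
    · have := triN_mono (show m + 1 ≤ K + 1 by omega)
      refine ⟨⟨h1, by omega⟩, ?_, h3⟩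
      rw [loN, if_pos (by omega), ← hm]
      omega
    · have hm1 : m = K + 1 := by omega
      rw [hm1] at b1 b2 e1
      simp only [Nat.add_assoc, Nat.reduceAdd] at b2 e1
      refine ⟨⟨h1, by omega⟩, ?_, h3⟩
      rw [hlo1 s (by omega) (by omega)]
      omega
  by_cases e2 : triN (m + 1) < e
  · have hm3 : m + 1 < K + 4 :=
      triN_strictMono.lt_iff_lt.1 (show triN (m + 1) < triN (K + 4) by omega)
    have hlet : ∀ M : ℕ, M % 2 = m % 2 → m ≤ M → ∀ t < e - s,
        letN (triN (M + 1) - (triN (m + 1) - s) + t) = letN (s + t) := by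
      intro M hM hmM t ht
      have M1 := triN_succ M
      have M2 := triN_succ (M + 1)
      rcases Nat.lt_or_ge (s + t) (triN (m + 1)) with hc | hc
      · rw [letN_eq (m := M) (by omega) (by omega), letN_eq (m := m) (by omega) (by omega), hM]
      · rw [letN_eq (m := M + 1) (by omega) (by omega),
          letN_eq (m := m + 1) (by omega) (by simp only [Nat.add_assoc, Nat.reduceAdd]; omega)]
        rw [show (M + 1) % 2 = (m + 1) % 2 by omega]
    rcases Nat.mod_two_eq_zero_or_one m with hp | hp
    · have hj : e - triN (m + 1) ≤ K + 3 := by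
        by_cases hmm : m = K + 2
        · rw [hmm] at e2 ⊢
          simp only [Nat.add_assoc, Nat.reduceAdd] at *
          omega
        · omega
      refine ⟨⟨triN (K + 3) - (triN (m + 1) - s), triN (K + 3) + (e - triN (m + 1))⟩, ?_, ?_⟩
      · rw [mem_canN, hlo2 _ (by omega) (by omega)]
        omega
      · rw [facN_eq_iff]
        refine ⟨by simp only; omega, fun t ht => hlet (K + 2) (by omega) (by omega) t ?_⟩
        simp only at ht; omega
    · refine ⟨⟨triN (K + 2) - (triN (m + 1) - s), triN (K + 2) + (e - triN (m + 1))⟩, ?_, ?_⟩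
      · rw [mem_canN, hlo1 _ (by omega) (by omega)]
        omega
      · rw [facN_eq_iff]
        refine ⟨by simp only; omega, fun t ht => hlet (K + 1) (by omega) (by omega) t ?_⟩
        simp only at ht; omega
  · rcases Nat.mod_two_eq_zero_or_one m with hp | hp
    · refine ⟨⟨triN (K + 3) - (e - s), triN (K + 3)⟩, ?_, ?_⟩
      · rw [mem_canN, hlo2 _ (by omega) (by omega)]
        omega
      · rw [facN_eq_iff]
        refine ⟨by simp only; omega, fun t ht => ?_⟩
        simp only at ht ⊢
        rw [letN_eq (m := K + 2) (by omega) (by simp only [Nat.add_assoc, Nat.reduceAdd]; omega),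
          letN_eq (m := m) (by omega) (by omega), if_pos (by omega), if_pos hp]
    · have hj : e - s ≤ K + 3 := by
        by_cases hmm : m = K + 3
        · rw [hmm] at b1
          omega
        · omega
      refine ⟨⟨triN (K + 3), triN (K + 3) + (e - s)⟩, ?_, ?_⟩
      · rw [mem_canN, hlo3]
        omega
      · rw [facN_eq_iff]
        refine ⟨by simp only; omega, fun t ht => ?_⟩
        simp only at ht ⊢
        rw [letN_eq (m := K + 3) (by omega) (by simp only [Nat.add_assoc, Nat.reduceAdd]; omega),
          letN_eq (m := m) (by omega) (by omega), if_neg (by omega), if_neg (by omega)]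

theorem triN_cast (m : ℕ) : (triN m : ℚ) = m * (m + 1) / 2 := by
  have := triN_two m
  have h : (2 : ℚ) * triN m = m * (m + 1) := by exact_mod_cast this
  linarith

theorem canN_sum1 (N : ℚ) (M : ℕ) :
    ∑ s ∈ Finset.Ico 1 (triN (M + 1)), (N - triN (blkN s + 2)) =
      N * (triN (M + 1) - 1) - (M + 1) * (M + 2) * (M + 3) * (M + 4) / 8 + 3 := by
  induction M with
  | zero => simp [triN]; norm_num
  | succ M ih =>
    rw [← Finset.sum_Ico_consecutive _ (le_trans (by omega) (le_triN (M + 1)))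
      (triN_mono (Nat.le_succ (M + 1))), ih]
    have : ∑ s ∈ Finset.Ico (triN (M + 1)) (triN (M + 1 + 1)), (N - triN (blkN s + 2)) =
        ∑ s ∈ Finset.Ico (triN (M + 1)) (triN (M + 1 + 1)), (N - triN (M + 1 + 2)) := by
      refine Finset.sum_congr rfl fun s hs => ?_
      rw [Finset.mem_Ico] at hs
      rw [blkN_eq hs.1 hs.2]
    rw [Nat.succ_eq_add_one, this, Finset.sum_const, Nat.card_Ico, triN_succ (M + 1),
      Nat.add_sub_cancel_left]
    simp only [nsmul_eq_mul, triN_cast, Nat.cast_add]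
    push_cast
    ring

theorem canN_card (K : ℕ) : ((canN K).card : ℚ) =
    (triN (K + 4) : ℚ) ^ 2 / 2 + 5 / 2 * triN (K + 4) - (K + 4) * triN (K + 4)
      - 3 * (K + 4) + 4 := by
  have t1 := triN_succ K
  have t2 := triN_succ (K + 1)
  have t3 := triN_succ (K + 2)
  have t4 := triN_succ (K + 3)
  simp only [Nat.add_assoc, Nat.reduceAdd] at t2 t3 t4
  have q0 : 1 ≤ triN (K + 1) := le_trans (by omega) (le_triN (K + 1))
  have hc : ((canN K).card : ℚ) = ∑ s ∈ Finset.Ico 1 (triN (K + 3) + 1),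
      ((triN (K + 4) : ℚ) - loN K s) := by
    rw [canN, Finset.card_sigma, Nat.cast_sum]
    refine Finset.sum_congr rfl fun s hs => ?_
    rw [Nat.card_Ico, Nat.cast_sub]
    rw [Finset.mem_Ico] at hs
    unfold loN
    split_ifs with c1
    · have := blkN_le s
      have : blkN s < K + 1 :=
        triN_strictMono.lt_iff_lt.1 (show triN (blkN s) < triN (K + 1) by omega)
      have := triN_mono (show blkN s + 2 ≤ K + 2 by omega)
      omega
    all_goals omega
  rw [hc, Finset.sum_Ico_succ_top (by omega),
    ← Finset.sum_Ico_consecutive _ (show 1 ≤ triN (K + 2) by omega)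
      (show triN (K + 2) ≤ triN (K + 3) by omega),
    ← Finset.sum_Ico_consecutive _ q0 (show triN (K + 1) ≤ triN (K + 2) by omega)]
  have s1 : ∑ s ∈ Finset.Ico 1 (triN (K + 1)), ((triN (K + 4) : ℚ) - loN K s) =
      ∑ s ∈ Finset.Ico 1 (triN (K + 1)), (((triN (K + 4) : ℚ) - 1) - triN (blkN s + 2)) := by
    refine Finset.sum_congr rfl fun s hs => ?_
    rw [Finset.mem_Ico] at hs
    rw [loN, if_pos hs.2]
    push_cast; ring
  have s2 : ∑ s ∈ Finset.Ico (triN (K + 1)) (triN (K + 2)), ((triN (K + 4) : ℚ) - loN K s) =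
      ∑ s ∈ Finset.Ico (triN (K + 1)) (triN (K + 2)),
        (((triN (K + 4) : ℚ) - (triN (K + 2) + 1))) := by
    refine Finset.sum_congr rfl fun s hs => ?_
    rw [Finset.mem_Ico] at hs
    rw [loN, if_neg (by omega), if_pos hs.2]
    push_cast; ring
  have s3 : ∑ s ∈ Finset.Ico (triN (K + 2)) (triN (K + 3)), ((triN (K + 4) : ℚ) - loN K s) =
      ∑ s ∈ Finset.Ico (triN (K + 2)) (triN (K + 3)),
        (((triN (K + 4) : ℚ) - triN (K + 3))) := by
    refine Finset.sum_congr rfl fun s hs => ?_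
    rw [Finset.mem_Ico] at hs
    rw [loN, if_neg (by omega), if_neg (by omega), if_pos hs.2]
  have s4 : loN K (triN (K + 3)) = triN (K + 3) + 1 := by
    rw [loN, if_neg (by omega), if_neg (by omega), if_neg (by omega)]
  rw [s1, s2, s3, s4, canN_sum1, Finset.sum_const, Finset.sum_const, Nat.card_Ico, Nat.card_Ico,
    show triN (K + 2) - triN (K + 1) = K + 2 by omega,
    show triN (K + 3) - triN (K + 2) = K + 3 by omega]
  simp only [nsmul_eq_mul, triN_cast, Nat.cast_add]
  push_cast
  ring

/-- For even k ≥ 4, the word w = a b² a³ b⁴ ⋯ a^{k-1} b^k of length n = k(k+1)/2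
has σ(Σ* w Σ*) = (3/2)n² + (5/2)n − kn − 3k + 5. -/
theorem stmt17 (k n : ℕ) (hk : 4 ≤ k) (hkeven : Even k)
    (hn : n = (blockWord k).length) (hn' : n = k * (k + 1) / 2) :
    (syntacticComplexity (factorLang (blockWord k)) : ℚ) =
      3 / 2 * (n : ℚ) ^ 2 + 5 / 2 * (n : ℚ) - (k : ℚ) * (n : ℚ) - 3 * (k : ℚ) + 5 := by
  obtain ⟨K, rfl⟩ : ∃ K, k = K + 4 := ⟨k - 4, by omega⟩
  have hK : K % 2 = 0 := by
    have := Nat.even_iff.1 hkeven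
    omega
  have hlen : n = triN (K + 4) := by rw [hn, blockWord_eq, facN_length]; omega
  have t4 := triN_succ (K + 3)
  simp only [Nat.add_assoc, Nat.reduceAdd] at t4
  have h10 : 10 ≤ triN (K + 4) := triN_mono (show 4 ≤ K + 4 by omega)
  have hW := blockWord_eq (K + 4)
  have l0 : letN 0 = Letter.a := by decide
  have l1 : letN 1 = Letter.b := by decide
  have l3 : letN 3 = Letter.a := by decide
  have ha : blockWord (K + 4) = Letter.a :: facN 1 (triN (K + 4)) := by
    rw [hW, ← facN_append (m := 1) (by omega) (by omega)]
    simp [facN, l0]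
  have hb : blockWord (K + 4) = facN 0 (triN (K + 4) - 1) ++ [Letter.b] := by
    rw [hW, ← facN_append (m := triN (K + 4) - 1) (by omega) (by omega)]
    congr 1
    rw [facN, show triN (K + 4) - (triN (K + 4) - 1) = 1 by omega]
    simp only [List.range'_one, List.map_cons, List.map_nil]
    rw [letN_eq (m := K + 3) (by omega) (by simp only [Nat.add_assoc, Nat.reduceAdd]; omega),
      if_neg (by omega)]
  have hab : ∀ i j, blockWord (K + 4) ≠
      List.replicate i Letter.a ++ List.replicate j Letter.b := by
    intro i j h
    have g : ∀ t < triN (K + 4), (blockWord (K + 4))[t]? = some (letN t) := by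
      intro t ht
      rw [hW, facN, List.getElem?_map, List.getElem?_range' (by omega)]
      simp
    have g1 := g 1 (by omega)
    have g3 := g 3 (by omega)
    rw [l1, h, List.getElem?_append] at g1
    rw [l3, h, List.getElem?_append] at g3
    simp only [List.length_replicate, List.getElem?_replicate] at g1 g3
    split_ifs at g1 g3 <;> simp at g1 g3
    all_goals omega
  have hI : ∀ u, u ∈ (canN K).image (fun z : Σ _ : ℕ, ℕ => facN z.1 z.2) ↔
      u ≠ [] ∧ InnerIn (blockWord (K + 4)) u := by
    intro u
    rw [innerIn_iff, Finset.mem_image]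
    constructor
    · rintro ⟨⟨s, e⟩, hz, rfl⟩
      rw [mem_canN] at hz
      have := lt_of_loN hz.1.2 hz.2.1
      refine ⟨?_, s, e, hz.1.1, by omega, hz.2.2, rfl⟩
      rw [← List.length_pos_iff, facN_length]
      simp only; omega
    · rintro ⟨hne, s, e, h1, h2, h3, rfl⟩
      rw [← List.length_pos_iff, facN_length] at hne
      exact canN_surj hK h1 (by omega) h3
  rw [syntacticComplexity_eq ha hb hab _ hI, Finset.card_image_of_injOn (canN_inj hK), ← hn, hlen]
  push_cast
  rw [canN_card]
  ring
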